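/- arXiv:2605.19599 — 4 statements merged into one kernel-verified Lean document; each statement's English description precedes it below -/
import Mathlib

section
/- Let N ≥ 2 be an integer, α ∈ (0,1), β ∈ (α,1) and M > 0. Let Ω ⊆ ℝ^N be a bounded open set contained in {x : 0 < x_N < M}. Then for every smooth function u : ℝ^N → ℝ with compact support contained in Ω, one has ∫_Ω x_N^{α−2} u(x)² dx ≤ (1/((1−β)(β−α))) ∫_Ω x_N^α (∂u/∂x_N)(x)² dx. -/
open MeasureTheory Set Filter

/-- Partial derivative of `u` in the `i`-th coordinate direction. -/
noncomputable def pd {N : ℕ} (i : Fin N) (u : (Fin N → ℝ) → ℝ) (x : Fin N → ℝ) : ℝ :=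
  fderiv ℝ u x (Pi.single i 1)

theorem contDiff_rpow_coord_mul {N : ℕ} (n : Fin N) {m : ℕ∞} {w : (Fin N → ℝ) → ℝ}
    (hw : ContDiff ℝ m w) (h0 : ∀ x ∈ tsupport w, x n ≠ 0) (a : ℝ) :
    ContDiff ℝ m fun x => x n ^ a * w x := by
  refine contDiff_iff_contDiffAt.2 fun x => ?_
  by_cases hx : x ∈ tsupport w
  · exact ((contDiff_apply ℝ ℝ n).contDiffAt.rpow_const_of_ne (h0 x hx)).mul hw.contDiffAt
  · refine (contDiffAt_const (c := (0 : ℝ))).congr_of_eventuallyEq ?_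
    filter_upwards [notMem_tsupport_iff_eventuallyEq.1 hx] with y hy
    simp [hy]

theorem integrable_rpow_coord_mul {N : ℕ} (n : Fin N) {w : (Fin N → ℝ) → ℝ}
    (hw : ContDiff ℝ 0 w) (hc : HasCompactSupport w) (h0 : ∀ x ∈ tsupport w, x n ≠ 0) (a : ℝ) :
    Integrable fun x => x n ^ a * w x :=
  (contDiff_rpow_coord_mul (m := 0) n hw h0 a).continuous.integrable_of_hasCompactSupport
    hc.mul_left

theorem contDiff_pd {N : ℕ} (i : Fin N) {u : (Fin N → ℝ) → ℝ} {m : ℕ∞}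
    (hu : ContDiff ℝ (m + 1) u) : ContDiff ℝ m (pd i u) :=
  (hu.fderiv_right le_rfl).clm_apply contDiff_const

theorem tsupport_pd_subset {N : ℕ} (i : Fin N) (u : (Fin N → ℝ) → ℝ) :
    tsupport (pd i u) ⊆ tsupport u :=
  tsupport_fderiv_apply_subset ℝ _

theorem integrable_pd {N : ℕ} (i : Fin N) {v : (Fin N → ℝ) → ℝ}
    (hv : ContDiff ℝ 1 v) (hc : HasCompactSupport v) : Integrable (pd i v) :=
  (contDiff_pd (m := 0) i (by simpa using hv)).continuous.integrable_of_hasCompactSupport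
    (hc.mono' (subset_tsupport _ |>.trans (tsupport_pd_subset i v)))

theorem integral_pd_eq_zero {N : ℕ} (i : Fin N) {v : (Fin N → ℝ) → ℝ}
    (hv : ContDiff ℝ 1 v) (hc : HasCompactSupport v) : ∫ x, pd i v x = 0 := by
  have h := integral_mul_fderiv_eq_neg_fderiv_mul_of_integrable (μ := volume)
    (f := fun _ : Fin N → ℝ => (1 : ℝ)) (g := v) (v := Pi.single i 1)
    (by simp) (by simp only [one_mul]; exact integrable_pd i hv hc)
    (by simpa using hv.continuous.integrable_of_hasCompactSupport hc)
    (fun _ _ => differentiableAt_const _)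
    (fun x _ => hv.differentiable one_ne_zero x)
  simpa [pd] using h

theorem pd_rpow_coord_mul_sq {N : ℕ} (n : Fin N) {u : (Fin N → ℝ) → ℝ} {x : Fin N → ℝ}
    (hu : DifferentiableAt ℝ u x) (hx : x n ≠ 0) (a : ℝ) :
    pd n (fun y => y n ^ a * u y ^ 2) x
      = a * x n ^ (a - 1) * u x ^ 2 + 2 * x n ^ a * u x * pd n u x := by
  have h1 : HasFDerivAt (fun y : Fin N → ℝ => y n)
      (ContinuousLinearMap.proj (R := ℝ) (φ := fun _ : Fin N => ℝ) n) x :=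
    hasFDerivAt_apply n x
  have h2 := (h1.rpow_const (p := a) (Or.inl hx)).mul (hu.hasFDerivAt.pow 2)
  unfold pd
  rw [HasFDerivAt.fderiv (f := fun y : Fin N → ℝ => y n ^ a * u y ^ 2) h2]
  simp
  ring

/-- Pointwise form of the Hardy estimate, from completing the square. -/
theorem hardy_pointwise {t : ℝ} (ht : 0 < t) (α β p q : ℝ) :
    (1 - β) * (β - α) * (t ^ (α - 2) * p ^ 2)
        + (1 - β) * ((α - 1) * t ^ (α - 1 - 1) * p ^ 2 + 2 * t ^ (α - 1) * p * q)
      ≤ t ^ α * q ^ 2 := by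
  have e0 : t ^ α = t ^ (α - 2) * t ^ 2 := by
    rw [← Real.rpow_natCast, ← Real.rpow_add ht]; norm_num
  have e1 : t ^ (α - 1) = t ^ (α - 2) * t := by
    rw [← Real.rpow_add_one ht.ne']; ring_nf
  have e2 : α - 1 - 1 = α - 2 := by ring
  rw [e0, e1, e2]
  have h := mul_nonneg (Real.rpow_pos_of_pos ht (α - 2)).le (sq_nonneg (t * q - (1 - β) * p))
  linarith

/-- Key intermediate Hardy estimate with parameter `β ∈ (α,1)` (proof of Lemma 2.2). -/
theorem hardy_intermediate (N : ℕ) (hN : 2 ≤ N) (n : Fin N) (hn : (n : ℕ) = N - 1)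
    (α β M : ℝ) (hα : α ∈ Ioo (0 : ℝ) 1) (hβ : β ∈ Ioo α 1) (hM : 0 < M)
    (Ω : Set (Fin N → ℝ)) (hΩo : IsOpen Ω) (hΩb : Bornology.IsBounded Ω)
    (hΩs : Ω ⊆ {x | 0 < x n ∧ x n < M})
    (u : (Fin N → ℝ) → ℝ) (hu : ContDiff ℝ (⊤ : ℕ∞) u) (hcs : HasCompactSupport u)
    (hsupp : tsupport u ⊆ Ω) :
    ∫ x in Ω, x n ^ (α - 2) * (u x) ^ 2
      ≤ (1 / ((1 - β) * (β - α))) * ∫ x in Ω, x n ^ α * (pd n u x) ^ 2 := by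
  have hpos : ∀ x ∈ tsupport u, 0 < x n := fun x hx => (hΩs (hsupp hx)).1
  have hu0 : ∀ x ∉ tsupport u, u x = 0 := fun x hx => image_eq_zero_of_notMem_tsupport hx
  have hp0 : ∀ x ∉ tsupport u, pd n u x = 0 := fun x hx =>
    image_eq_zero_of_notMem_tsupport fun h => hx (tsupport_pd_subset n u h)
  have hsq : tsupport (fun x => u x ^ 2) ⊆ tsupport u :=
    closure_minimal (fun x hx => by
      by_contra h; exact hx (by simp [hu0 x h])) (isClosed_tsupport u)
  have hpsq : tsupport (fun x => pd n u x ^ 2) ⊆ tsupport u :=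
    closure_minimal (fun x hx => by
      by_contra h; exact hx (by simp [hp0 x h])) (isClosed_tsupport u)
  have hcsq : HasCompactSupport fun x => u x ^ 2 := hcs.mono' ((subset_tsupport _).trans hsq)
  have hcpsq : HasCompactSupport fun x => pd n u x ^ 2 :=
    hcs.mono' ((subset_tsupport _).trans hpsq)
  have hu1 : ContDiff ℝ 1 u := hu.of_le (by exact_mod_cast le_top)
  have hv : ContDiff ℝ 1 fun x => x n ^ (α - 1) * u x ^ 2 :=
    contDiff_rpow_coord_mul (m := 1) n (hu1.pow 2) (fun x hx => (hpos x (hsq hx)).ne') _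
  have hvc : HasCompactSupport fun x => x n ^ (α - 1) * u x ^ 2 := hcsq.mul_left
  have hi1 : Integrable fun x => x n ^ (α - 2) * u x ^ 2 :=
    integrable_rpow_coord_mul n ((hu1.of_le zero_le_one).pow 2) hcsq
      (fun x hx => (hpos x (hsq hx)).ne') _
  have hi2 : Integrable fun x => x n ^ α * pd n u x ^ 2 :=
    integrable_rpow_coord_mul n ((contDiff_pd (m := 0) n (by simpa using hu1)).pow 2) hcpsq
      (fun x hx => (hpos x (hpsq hx)).ne') _
  rw [setIntegral_eq_integral_of_forall_compl_eq_zero fun x hx => by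
      simp [hu0 x fun h => hx (hsupp h)],
    setIntegral_eq_integral_of_forall_compl_eq_zero fun x hx => by
      simp [hp0 x fun h => hx (hsupp h)]]
  have hpt : ∀ x, (1 - β) * (β - α) * (x n ^ (α - 2) * u x ^ 2)
      + (1 - β) * pd n (fun y => y n ^ (α - 1) * u y ^ 2) x ≤ x n ^ α * pd n u x ^ 2 := by
    intro x
    by_cases hx : x ∈ tsupport u
    · rw [pd_rpow_coord_mul_sq n (hu1.differentiable one_ne_zero x) (hpos x hx).ne']
      exact hardy_pointwise (hpos x hx) α β _ _
    · have : pd n (fun y => y n ^ (α - 1) * u y ^ 2) x = 0 :=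
        image_eq_zero_of_notMem_tsupport fun h =>
          hx (hsq (tsupport_mul_subset_right (tsupport_pd_subset n _ h)))
      simp [this, hu0 x hx, hp0 x hx]
  have hint := integral_mono ((hi1.const_mul _).add ((integrable_pd n hv hvc).const_mul _)) hi2 hpt
  simp only [Pi.add_apply] at hint
  rw [integral_add (hi1.const_mul _) ((integrable_pd n hv hvc).const_mul _),
    integral_const_mul, integral_const_mul, integral_pd_eq_zero n hv hvc, mul_zero,
    add_zero] at hint
  have hk : 0 < (1 - β) * (β - α) := mul_pos (sub_pos.2 hβ.2) (sub_pos.2 hβ.1)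
  rw [one_div, ← div_eq_inv_mul, le_div_iff₀ hk, mul_comm]
  exact hint
end

section
/- Let N ≥ 2 be an integer, α ∈ (0,1) and M > 0. Let Ω ⊆ ℝ^N be a bounded open set contained in {x : 0 < x_N < M}. Then for every r > 0 and every smooth function u : ℝ^N → ℝ with compact support contained in Ω, one has ∫_{Ω ∩ {x_N < r}} u(x)² dx ≤ r^{2−α} · (4/(1−α)²) · ∫_Ω x_N^α (∂u/∂x_N)(x)² dx. -/
open MeasureTheory Set Filter

/-- Multiplying by a power of a coordinate preserves integrability of continuous functions compactly
supported where that coordinate is positive. -/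
theorem integrable_coord_rpow_mul {N : ℕ} (n : Fin N) (β : ℝ) {g : (Fin N → ℝ) → ℝ}
    (hg : Continuous g) (hgc : HasCompactSupport g) (hgs : tsupport g ⊆ {x | 0 < x n}) :
    Integrable fun x ↦ x n ^ β * g x := by
  refine Continuous.integrable_of_hasCompactSupport ?_ hgc.mul_left
  refine continuous_of_tsupport fun x hx ↦ ?_
  have hx0 : 0 < x n := hgs (closure_mono (Function.support_mul_subset_right _ _) hx)
  have hc : ContinuousAt (fun y : Fin N → ℝ ↦ y n) x := (continuous_apply n).continuousAt
  exact (hc.rpow_const (Or.inl hx0.ne')).mul hg.continuousAt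

/-- Weighted Hardy inequality in a half-space, in the direction of the `n`-th coordinate. -/
theorem hardy_coord_rpow {N : ℕ} (n : Fin N) {α : ℝ} (hα : α < 1) {u : (Fin N → ℝ) → ℝ}
    (hu : ContDiff ℝ 1 u) (hcs : HasCompactSupport u) (hsupp : tsupport u ⊆ {x | 0 < x n}) :
    ∫ x, x n ^ (α - 2) * u x ^ 2 ≤ 4 / (1 - α) ^ 2 * ∫ x, x n ^ α * pd n u x ^ 2 := by
  have hd : Continuous (pd n u) := (hu.continuous_fderiv one_ne_zero).clm_apply continuous_const
  have hdu (x) : HasLineDerivAt ℝ u (pd n u x) x (Pi.single n 1) :=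
    ((hu.differentiable one_ne_zero) x).hasFDerivAt.hasLineDerivAt _
  have hdc : HasCompactSupport (pd n u) := hcs.fderiv_apply ℝ _
  have hds : tsupport (pd n u) ⊆ {x | 0 < x n} := (tsupport_fderiv_apply_subset ℝ _).trans hsupp
  have hsq : tsupport (fun x ↦ u x ^ 2) ⊆ {x | 0 < x n} :=
    (tsupport_comp_subset (g := fun t : ℝ ↦ t ^ 2) (by simp) u).trans hsupp
  have hsqc : HasCompactSupport fun x ↦ u x ^ 2 :=
    hcs.comp_left (g := fun t : ℝ ↦ t ^ 2) (by simp)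
  have hI₀ (β : ℝ) : Integrable fun x ↦ x n ^ β * u x ^ 2 :=
    integrable_coord_rpow_mul n β (hu.continuous.pow 2) hsqc hsq
  have hI₁ : Integrable fun x ↦ x n ^ (α - 1) * (2 * u x * pd n u x) :=
    integrable_coord_rpow_mul n _ ((continuous_const.mul hu.continuous).mul hd) hdc.mul_left
      ((tsupport_mul_subset_right (f := fun x ↦ 2 * u x)).trans hds)
  have hI₂ : Integrable fun x ↦ x n ^ α * pd n u x ^ 2 :=
    integrable_coord_rpow_mul n α (hd.pow 2) (hdc.comp_left (g := fun t : ℝ ↦ t ^ 2) (by simp))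
      ((tsupport_comp_subset (g := fun t : ℝ ↦ t ^ 2) (by simp) _).trans hds)
  have hI₀' : Integrable fun x ↦ (α - 1) * x n ^ (α - 2) * u x ^ 2 := by
    simpa only [mul_assoc] using (hI₀ (α - 2)).const_mul (α - 1)
  have hparts : ∫ x, x n ^ (α - 1) * (2 * u x * pd n u x)
      = (1 - α) * ∫ x, x n ^ (α - 2) * u x ^ 2 := by
    have h := integral_bilinear_hasLineDerivAt_right_eq_neg_left_of_integrable
      (μ := volume) (B := ContinuousLinearMap.mul ℝ ℝ) (f := fun x : Fin N → ℝ ↦ x n ^ (α - 1))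
      (f' := fun x ↦ (α - 1) * x n ^ (α - 2)) (g := fun x ↦ u x ^ 2)
      (g' := fun x ↦ 2 * u x * pd n u x) (v := Pi.single n 1)
      hI₀' hI₁ (hI₀ (α - 1)) (fun x hx ↦ ?_) (fun x _ ↦ ?_)
    · simp only [ContinuousLinearMap.mul_apply', mul_assoc, integral_const_mul] at h ⊢
      linarith
    · have hx0 : 0 < x n := hsq hx
      have h1 : HasDerivAt (fun t : ℝ ↦ x n + t) 1 0 := (hasDerivAt_id 0).const_add _
      have h2 := h1.rpow_const (p := α - 1) (Or.inl (by simpa using hx0.ne'))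
      simp only [HasLineDerivAt, Pi.add_apply, Pi.smul_apply, Pi.single_eq_same, smul_eq_mul,
        mul_one]
      rw [add_zero, one_mul, sub_sub, one_add_one_eq_two] at h2
      exact h2
    · have h1 := HasDerivAt.pow (hdu x) 2
      simp only [zero_smul, add_zero, Nat.cast_ofNat, Nat.add_one_sub_one, pow_one] at h1
      exact h1
  have hyoung : ∫ x, x n ^ (α - 1) * (2 * u x * pd n u x)
      ≤ ∫ x, ((1 - α) / 2 * (x n ^ (α - 2) * u x ^ 2)
        + 2 / (1 - α) * (x n ^ α * pd n u x ^ 2)) := by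
    refine integral_mono hI₁ (((hI₀ _).const_mul _).add (hI₂.const_mul _)) fun x ↦ ?_
    by_cases hx : x ∈ tsupport u
    · have hx0 : 0 < x n := hsupp hx
      have h1 : x n ^ (α - 1) = x n ^ (α - 2) * x n := by
        rw [← Real.rpow_add_one hx0.ne']; ring_nf
      have h2 : x n ^ α = x n ^ (α - 2) * x n ^ 2 := by
        rw [← Real.rpow_natCast, ← Real.rpow_add hx0]; simp
      have hα' : 0 < 1 - α := sub_pos.2 hα
      have hkey : (1 - α) / 2 * (x n ^ (α - 2) * u x ^ 2) + 2 / (1 - α) * (x n ^ α * pd n u x ^ 2)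
          - x n ^ (α - 1) * (2 * u x * pd n u x)
          = x n ^ (α - 2) * (((1 - α) * u x - 2 * x n * pd n u x) ^ 2 / (2 * (1 - α))) := by
        rw [h1, h2]; field_simp; ring
      have : 0 ≤ x n ^ (α - 2) * (((1 - α) * u x - 2 * x n * pd n u x) ^ 2 / (2 * (1 - α))) := by
        positivity
      simp only
      linarith
    · have hu0 : u x = 0 := image_eq_zero_of_notMem_tsupport hx
      have hd0 : pd n u x = 0 := image_eq_zero_of_notMem_tsupport fun h ↦
        hx (tsupport_fderiv_apply_subset ℝ _ h)
      simp [hu0, hd0]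
  rw [hparts, integral_add ((hI₀ _).const_mul _) (hI₂.const_mul _), integral_const_mul,
    integral_const_mul] at hyoung
  have hα' : 0 < 1 - α := sub_pos.2 hα
  rw [div_mul_eq_mul_div, le_div_iff₀ (by positivity)]
  field_simp at hyoung
  linarith

/-- Near-degenerate-boundary smallness estimate used in Corollary 2.1 (ii). -/
theorem strip_smallness (N : ℕ) (hN : 2 ≤ N) (n : Fin N) (hn : (n : ℕ) = N - 1)
    (α M : ℝ) (hα : α ∈ Ioo (0 : ℝ) 1) (hM : 0 < M)
    (Ω : Set (Fin N → ℝ)) (hΩo : IsOpen Ω) (hΩb : Bornology.IsBounded Ω)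
    (hΩs : Ω ⊆ {x | 0 < x n ∧ x n < M})
    (r : ℝ) (hr : 0 < r)
    (u : (Fin N → ℝ) → ℝ) (hu : ContDiff ℝ (⊤ : ℕ∞) u) (hcs : HasCompactSupport u)
    (hsupp : tsupport u ⊆ Ω) :
    ∫ x in Ω ∩ {x | x n < r}, (u x) ^ 2
      ≤ r ^ (2 - α) * (4 / (1 - α) ^ 2) * ∫ x in Ω, x n ^ α * (pd n u x) ^ 2 := by
  set v : (Fin N → ℝ) → ℝ := fun x ↦ x n ^ (α - 2) * u x ^ 2
  have hpos : tsupport u ⊆ {x | 0 < x n} := fun x hx ↦ (hΩs (hsupp hx)).1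
  have hu2c : HasCompactSupport fun x ↦ u x ^ 2 :=
    hcs.comp_left (g := fun t : ℝ ↦ t ^ 2) (by simp)
  have hv : Integrable v := integrable_coord_rpow_mul n _ (hu.continuous.pow 2) hu2c
    ((tsupport_comp_subset (g := fun t : ℝ ↦ t ^ 2) (by simp) u).trans hpos)
  have hv0 (x) : 0 ≤ v x := by
    by_cases hx : x ∈ tsupport u
    · have : 0 < x n := hpos hx
      positivity
    · simp [v, image_eq_zero_of_notMem_tsupport hx]
  have hΩ : ∫ x in Ω, x n ^ α * (pd n u x) ^ 2 = ∫ x, x n ^ α * (pd n u x) ^ 2 := by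
    refine setIntegral_eq_integral_of_forall_compl_eq_zero fun x hx ↦ ?_
    have hd0 : pd n u x = 0 := image_eq_zero_of_notMem_tsupport fun h ↦
      hx (hsupp (tsupport_fderiv_apply_subset ℝ _ h))
    simp [hd0]
  have hmeas : MeasurableSet (Ω ∩ {x | x n < r}) :=
    hΩo.measurableSet.inter (measurableSet_lt (measurable_pi_apply n) measurable_const)
  have hstrip : ∀ x ∈ Ω ∩ {x | x n < r}, u x ^ 2 ≤ r ^ (2 - α) * v x := by
    rintro x ⟨hxΩ, hxr⟩
    have hx0 : 0 < x n := (hΩs hxΩ).1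
    have hmul : x n ^ (2 - α) * v x = u x ^ 2 := by
      simp only [v]
      rw [← mul_assoc, ← Real.rpow_add hx0]
      simp
    rw [← hmul]
    exact mul_le_mul_of_nonneg_right
      (Real.rpow_le_rpow hx0.le hxr.le (by linarith [hα.2])) (hv0 x)
  rw [hΩ, mul_assoc]
  calc ∫ x in Ω ∩ {x | x n < r}, (u x) ^ 2
      ≤ ∫ x in Ω ∩ {x | x n < r}, r ^ (2 - α) * v x :=
        setIntegral_mono_on
          ((hu.continuous.pow 2).integrable_of_hasCompactSupport hu2c).integrableOn
          (hv.const_mul _).integrableOn hmeas hstrip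
    _ = r ^ (2 - α) * ∫ x in Ω ∩ {x | x n < r}, v x := integral_const_mul _ _
    _ ≤ r ^ (2 - α) * ∫ x, v x := by
        gcongr
        · exact .of_forall hv0
        · exact Measure.restrict_le_self
    _ ≤ _ := by
        gcongr
        exact hardy_coord_rpow n hα.2 (hu.of_le (by exact_mod_cast le_top)) hcs hpos
end

section
/- Let N ≥ 2 be an integer, α ∈ (0,1) and M > 0, and let Ω ⊆ ℝ^N be a bounded open set contained in {x : 0 < x_N < M}. Then for every λ ≥ 0 and every smooth function u : ℝ^N → ℝ with compact support contained in Ω, one has λ ∫_Ω u(x)² dx ≤ (λ²/2) ∫_Ω x_N^{2−α} u(x)² dx + (2/(1−α)²) ∫_Ω x_N^α (∂u/∂x_N)(x)² dx. -/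
open MeasureTheory Set Filter

theorem integral_fderiv_apply_eq_zero {E : Type*} [NormedAddCommGroup E] [NormedSpace ℝ E]
    [FiniteDimensional ℝ E] [MeasurableSpace E] [BorelSpace E] (μ : Measure E)
    [μ.IsAddHaarMeasure] {g : E → ℝ} (hg : ContDiff ℝ 1 g) (hcg : HasCompactSupport g) (v : E) :
    ∫ x, fderiv ℝ g x v ∂μ = 0 := by
  have hint : Integrable (fun x ↦ fderiv ℝ g x v) μ :=
    ((hg.continuous_fderiv one_ne_zero).clm_apply continuous_const).integrable_of_hasCompactSupport
      (hcg.fderiv_apply (𝕜 := ℝ) v)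
  simpa using integral_mul_fderiv_eq_neg_fderiv_mul_of_integrable (μ := μ) (𝕜 := ℝ)
    (f := fun _ ↦ (1 : ℝ)) (g := g) (v := v) (by simp) (by simpa using hint)
    (by simpa using hg.continuous.integrable_of_hasCompactSupport hcg)
    (fun x _ ↦ by fun_prop) (fun x _ ↦ hg.differentiable one_ne_zero x)

theorem contDiff_rpow_mul_sq {N : ℕ} (i : Fin N) (p : ℝ) {k : ℕ∞} {u : (Fin N → ℝ) → ℝ}
    (hu : ContDiff ℝ k u) (hpos : ∀ x ∈ tsupport u, 0 < x i) :
    ContDiff ℝ k (fun x : Fin N → ℝ ↦ x i ^ p * u x ^ 2) := by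
  refine contDiff_iff_contDiffAt.2 fun x ↦ ?_
  by_cases hx : x ∈ tsupport u
  · exact ((contDiff_apply ℝ ℝ i).contDiffAt.rpow_const_of_ne (hpos x hx).ne').mul
      (hu.contDiffAt.pow 2)
  · refine (contDiffAt_const (c := (0 : ℝ))).congr_of_eventuallyEq ?_
    filter_upwards [notMem_tsupport_iff_eventuallyEq.1 hx] with y hy
    simp [hy]

theorem pd_rpow_mul_sq {N : ℕ} (i : Fin N) (p : ℝ) {u : (Fin N → ℝ) → ℝ} {x : Fin N → ℝ}
    (hu : DifferentiableAt ℝ u x) (hx : 0 < x i) :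
    pd i (fun y ↦ y i ^ p * u y ^ 2) x
      = p * x i ^ (p - 1) * u x ^ 2 + x i ^ p * (2 * u x * pd i u x) := by
  have hi : HasFDerivAt (fun y : Fin N → ℝ ↦ y i) (ContinuousLinearMap.proj i) x :=
    hasFDerivAt_apply (𝕜 := ℝ) i x
  have h := (hi.rpow_const (p := p) (Or.inl hx.ne')).mul (hu.hasFDerivAt.pow 2)
  have h' := congrArg (fun L ↦ L (Pi.single i 1)) h.fderiv
  simp only [pd]
  refine Eq.trans h' ?_
  simp
  ring

/-- Young's inequality applied to both terms, with the divergence term kept explicit. -/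
theorem interpolation_pointwise {α t : ℝ} (hα : α < 1) (ht : 0 < t) (l a d : ℝ) :
    l * a ^ 2 ≤ l ^ 2 / 2 * (t ^ (2 - α) * a ^ 2) + 2 / (1 - α) ^ 2 * (t ^ α * d ^ 2)
      - 1 / (1 - α) * ((α - 1) * t ^ (α - 1 - 1) * a ^ 2 + t ^ (α - 1) * (2 * a * d)) := by
  have hβ : 0 < 1 - α := by linarith
  have hq : 0 < t ^ α := Real.rpow_pos_of_pos ht α
  have h₂ : t ^ (2 - α) = t ^ 2 / t ^ α := by rw [Real.rpow_sub ht, Real.rpow_two]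
  rw [h₂, Real.rpow_sub_one ht.ne', Real.rpow_sub_one ht.ne', ← sub_nonneg,
    show α - 1 = -(1 - α) by ring]
  generalize t ^ α = q at *
  generalize 1 - α = β at *
  have : 0 ≤ (l * t ^ 2 - q) ^ 2 / (2 * q * t ^ 2) * a ^ 2
      + q / 2 * (a / t - 2 * d / β) ^ 2 := by positivity
  refine this.trans_eq ?_
  field_simp
  ring

/-- Interpolation inequality used in Section 5 to pass from the weighted Carleman
estimate to the unweighted L² norm. -/
theorem interpolation_inequality (N : ℕ) (hN : 2 ≤ N) (n : Fin N) (hn : (n : ℕ) = N - 1)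
    (α M : ℝ) (hα : α ∈ Ioo (0 : ℝ) 1) (hM : 0 < M)
    (Ω : Set (Fin N → ℝ)) (hΩo : IsOpen Ω) (hΩb : Bornology.IsBounded Ω)
    (hΩs : Ω ⊆ {x | 0 < x n ∧ x n < M})
    (l : ℝ) (hl : 0 ≤ l)
    (u : (Fin N → ℝ) → ℝ) (hu : ContDiff ℝ (⊤ : ℕ∞) u) (hcs : HasCompactSupport u)
    (hsupp : tsupport u ⊆ Ω) :
    l * ∫ x in Ω, (u x) ^ 2
      ≤ (l ^ 2 / 2) * (∫ x in Ω, x n ^ (2 - α) * (u x) ^ 2)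
        + (2 / (1 - α) ^ 2) * ∫ x in Ω, x n ^ α * (pd n u x) ^ 2 := by
  obtain ⟨hα0, hα1⟩ := hα
  have hu1 : ContDiff ℝ 1 u := hu.of_le (by exact_mod_cast le_top)
  have hpos : ∀ x ∈ tsupport u, 0 < x n := fun x hx ↦ (hΩs (hsupp hx)).1
  have hzero : ∀ x ∉ tsupport u, u x = 0 := fun x hx ↦ image_eq_zero_of_notMem_tsupport hx
  have hzero' : ∀ x ∉ tsupport u, pd n u x = 0 := fun x hx ↦ by
    simp [pd, fderiv_of_notMem_tsupport ℝ hx]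
  have hupd : Continuous (pd n u) :=
    (hu1.continuous_fderiv one_ne_zero).clm_apply continuous_const
  set g : (Fin N → ℝ) → ℝ := fun x ↦ x n ^ (α - 1) * u x ^ 2 with hg
  have hg1 : ContDiff ℝ 1 g := contDiff_rpow_mul_sq (k := 1) n (α - 1) hu1 hpos
  have hgc : HasCompactSupport g := hcs.mono' <| by
    intro x hx
    by_contra h
    exact hx (by simp [hg, hzero x h])
  have hgpd : Integrable (pd n g) :=
    ((hg1.continuous_fderiv one_ne_zero).clm_apply continuous_const).integrable_of_hasCompactSupport
      (hgc.fderiv_apply (𝕜 := ℝ) _)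
  have hgint : ∫ x, pd n g x = 0 := integral_fderiv_apply_eq_zero volume hg1 hgc _
  have hi₁ : Integrable fun x ↦ u x ^ 2 :=
    (hu1.continuous.pow 2).integrable_of_hasCompactSupport <|
      HasCompactSupport.intro hcs fun x hx ↦ by simp [hzero x hx]
  have hi₂ : Integrable fun x : Fin N → ℝ ↦ x n ^ (2 - α) * u x ^ 2 :=
    (((Real.continuous_rpow_const (by linarith)).comp (continuous_apply n)).mul
      (hu1.continuous.pow 2)).integrable_of_hasCompactSupport <|
      HasCompactSupport.intro hcs fun x hx ↦ by simp [hzero x hx]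
  have hi₃ : Integrable fun x : Fin N → ℝ ↦ x n ^ α * pd n u x ^ 2 :=
    (((Real.continuous_rpow_const hα0.le).comp (continuous_apply n)).mul
      (hupd.pow 2)).integrable_of_hasCompactSupport <|
      HasCompactSupport.intro hcs fun x hx ↦ by simp [hzero' x hx]
  have hpt : ∀ x, l * u x ^ 2 ≤ l ^ 2 / 2 * (x n ^ (2 - α) * u x ^ 2)
      + 2 / (1 - α) ^ 2 * (x n ^ α * pd n u x ^ 2) - 1 / (1 - α) * pd n g x := by
    intro x
    by_cases hx : x ∈ tsupport u
    · rw [pd_rpow_mul_sq n (α - 1) (hu1.differentiable one_ne_zero x) (hpos x hx)]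
      exact interpolation_pointwise hα1 (hpos x hx) l (u x) (pd n u x)
    · have hgx : pd n g x = 0 := by
        have : g =ᶠ[nhds x] fun _ ↦ 0 := by
          filter_upwards [notMem_tsupport_iff_eventuallyEq.1 hx] with y hy
          simp [hg, hy]
        simp [pd, this.fderiv_eq]
      simp [hzero x hx, hzero' x hx, hgx]
  rw [setIntegral_eq_integral_of_forall_compl_eq_zero fun x hx ↦ by
      simp [hzero x (mt (@hsupp x) hx)],
    setIntegral_eq_integral_of_forall_compl_eq_zero fun x hx ↦ by
      simp [hzero x (mt (@hsupp x) hx)],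
    setIntegral_eq_integral_of_forall_compl_eq_zero fun x hx ↦ by
      simp [hzero' x (mt (@hsupp x) hx)]]
  have key := integral_mono (hi₁.const_mul l)
    (((hi₂.const_mul (l ^ 2 / 2)).add (hi₃.const_mul (2 / (1 - α) ^ 2))).sub
      (hgpd.const_mul (1 / (1 - α)))) hpt
  rw [integral_sub' ((hi₂.const_mul _).add (hi₃.const_mul _)) (hgpd.const_mul _),
    integral_add' (hi₂.const_mul _) (hi₃.const_mul _)] at key
  simpa only [integral_const_mul, hgint, mul_zero, sub_zero] using key
end

section
/- Let N ≥ 2, α ∈ (0,1), T > 0, γ ∈ ℝ, s > 0. Set Θ(t) = (t(T−t))^{−4} for t ∈ (0,T), ξ(x,t) = Θ(t)(γ − x_N^{2−α}), A(x) = diag(1,…,1,x_N^α). Let Ω ⊆ {x ∈ ℝ^N : x_N > 0} be a bounded open set, and let z be a smooth function on ℝ^N × ℝ with compact support contained in Ω × (0,T). Then ∫₀^T ∫_Ω (2s A∇z·∇ξ + s z div(A∇ξ)) · (s z ∂_tξ) dx dt = −(2−α)² s² ∫₀^T ∫_Ω Θ(t)Θ'(t) x_N^{2−α} z² dx dt.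 -/
open MeasureTheory Set Filter

/-- The temporal Carleman weight `Θ(t) = (t(T-t))⁻⁴`. -/
noncomputable def Theta (T : ℝ) : ℝ → ℝ := fun t => (t * (T - t)) ^ (-4 : ℤ)

/-- The Carleman weight `ξ(x,t) = Θ(t)(γ - x_N^{2-α})`, with `n` the last coordinate index. -/
noncomputable def xi {N : ℕ} (n : Fin N) (α T γ : ℝ) (y : Fin N → ℝ) (τ : ℝ) : ℝ :=
  Theta T τ * (γ - y n ^ (2 - α))

/-- `A∇f·∇g = Σ_{i≠n} ∂_i f ∂_i g + x_N^α ∂_N f ∂_N g` for `A = diag(1,…,1,x_N^α)`. -/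
noncomputable def agrad {N : ℕ} (α : ℝ) (n : Fin N) (f g : (Fin N → ℝ) → ℝ)
    (x : Fin N → ℝ) : ℝ :=
  (∑ i ∈ Finset.univ.erase n, pd i f x * pd i g x) + x n ^ α * pd n f x * pd n g x

/-- `div(A∇f) = Σ_{i≠n} ∂²f/∂x_i² + ∂/∂x_N (x_N^α ∂f/∂x_N)` for `A = diag(1,…,1,x_N^α)`. -/
noncomputable def divA {N : ℕ} (α : ℝ) (n : Fin N) (f : (Fin N → ℝ) → ℝ)
    (x : Fin N → ℝ) : ℝ :=
  (∑ i ∈ Finset.univ.erase n, pd i (fun y => pd i f y) x) +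
    pd n (fun y => y n ^ α * pd n f y) x

open Topology

section PartialDerivatives

variable {N : ℕ} {n : Fin N} {x : Fin N → ℝ}

theorem hasFDerivAt_comp_coord {g : ℝ → ℝ} {g' : ℝ} (hg : HasDerivAt g g' (x n)) :
    HasFDerivAt (fun y : Fin N → ℝ => g (y n))
      (g' • ContinuousLinearMap.proj (R := ℝ) (φ := fun _ : Fin N => ℝ) n) x :=
  hg.comp_hasFDerivAt x (hasFDerivAt_apply n x)

theorem pd_comp_coord_self {g : ℝ → ℝ} {g' : ℝ} (hg : HasDerivAt g g' (x n)) :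
    pd n (fun y => g (y n)) x = g' := by
  simp [pd, (hasFDerivAt_comp_coord hg).fderiv]

theorem pd_comp_coord_of_ne {g : ℝ → ℝ} {g' : ℝ} {i : Fin N} (hi : i ≠ n)
    (hg : HasDerivAt g g' (x n)) : pd i (fun y => g (y n)) x = 0 := by
  simp [pd, (hasFDerivAt_comp_coord hg).fderiv, hi.symm]

theorem pd_congr {i : Fin N} {f g : (Fin N → ℝ) → ℝ} (h : f =ᶠ[𝓝 x] g) :
    pd i f x = pd i g x := by
  rw [pd, pd, h.fderiv_eq]

theorem pd_coord_mul_sq {w : (Fin N → ℝ) → ℝ} (hw : DifferentiableAt ℝ w x) :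
    pd n (fun y => y n * w y ^ 2) x = 2 * x n * w x * pd n w x + w x ^ 2 := by
  have h : HasFDerivAt (fun y => y n * w y ^ 2) _ x :=
    (hasFDerivAt_apply (𝕜 := ℝ) n x).mul (hw.hasFDerivAt.pow 2)
  rw [pd, pd, h.fderiv]
  simp
  ring

end PartialDerivatives

section Weight

variable {N : ℕ} {n : Fin N} {α T γ t : ℝ} {x : Fin N → ℝ}

theorem hasDerivAt_weight (hα : α < 1) (c γ r : ℝ) :
    HasDerivAt (fun r : ℝ => c * (γ - r ^ (2 - α))) (-(2 - α) * c * r ^ (1 - α)) r := by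
  have h := (Real.hasDerivAt_rpow_const (x := r) (p := 2 - α) (Or.inr (by linarith)))
  rw [show 2 - α - 1 = 1 - α by ring] at h
  exact ((h.const_sub γ).const_mul c).congr_deriv (by ring)

theorem pd_xi_self (hα : α < 1) :
    pd n (fun y => xi n α T γ y t) x = -(2 - α) * Theta T t * x n ^ (1 - α) :=
  pd_comp_coord_self (hasDerivAt_weight hα (Theta T t) γ (x n))

theorem pd_xi_of_ne (hα : α < 1) {i : Fin N} (hi : i ≠ n) :
    pd i (fun y => xi n α T γ y t) x = 0 :=
  pd_comp_coord_of_ne hi (hasDerivAt_weight hα (Theta T t) γ (x n))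

theorem rpow_mul_pd_xi (hα : α < 1) (hx : 0 < x n) :
    x n ^ α * pd n (fun y => xi n α T γ y t) x = -(2 - α) * Theta T t * x n := by
  have h : x n ^ α * x n ^ (1 - α) = x n := by
    rw [← Real.rpow_add hx, add_sub_cancel, Real.rpow_one]
  rw [pd_xi_self hα]
  linear_combination (-(2 - α) * Theta T t) * h

theorem agrad_xi (hα : α < 1) (hx : 0 < x n) (w : (Fin N → ℝ) → ℝ) :
    agrad α n w (fun y => xi n α T γ y t) x = -(2 - α) * Theta T t * x n * pd n w x := by
  rw [agrad, Finset.sum_eq_zero fun i hi => by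
    rw [pd_xi_of_ne hα (Finset.ne_of_mem_erase hi), mul_zero]]
  linear_combination pd n w x * rpow_mul_pd_xi (T := T) (γ := γ) (t := t) hα hx

theorem divA_xi (hα : α < 1) (hx : 0 < x n) :
    divA α n (fun y => xi n α T γ y t) x = -(2 - α) * Theta T t := by
  have hsum : ∀ i ∈ Finset.univ.erase n,
      pd i (fun y => pd i (fun y' => xi n α T γ y' t) y) x = 0 := fun i hi => by
    simp only [pd_xi_of_ne hα (Finset.ne_of_mem_erase hi)]
    simp [pd]
  have hflux : (fun y : Fin N → ℝ => y n ^ α * pd n (fun y' => xi n α T γ y' t) y) =ᶠ[𝓝 x]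
      fun y => -(2 - α) * Theta T t * y n := by
    filter_upwards [(continuous_apply n).continuousAt.eventually (lt_mem_nhds hx)] with y hy
    exact rpow_mul_pd_xi hα hy
  rw [divA, Finset.sum_eq_zero hsum, zero_add, pd_congr hflux]
  exact pd_comp_coord_self (by simpa using (hasDerivAt_id (x n)).const_mul (-(2 - α) * Theta T t))

theorem deriv_xi : deriv (fun τ => xi n α T γ x τ) t =
    deriv (Theta T) t * (γ - x n ^ (2 - α)) := by
  simp only [xi]
  exact deriv_mul_const_field _

end Weight

/-- Integration by parts of `(γ - x_N^{2-α}) ∂_N (x_N w²)` for compactly supported `w`. -/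
theorem setIntegral_weight_mul_pd {N : ℕ} (n : Fin N) {α : ℝ} (hα : α < 1) (γ : ℝ)
    {Ω : Set (Fin N → ℝ)} (hΩ : MeasurableSet Ω) (hpos : Ω ⊆ {x | 0 < x n})
    {w : (Fin N → ℝ) → ℝ} (hw : ContDiff ℝ 1 w) (hc : HasCompactSupport w)
    (hsupp : tsupport w ⊆ Ω) :
    ∫ x in Ω, (γ - x n ^ (2 - α)) * (2 * x n * w x * pd n w x + w x ^ 2) =
      (2 - α) * ∫ x in Ω, x n ^ (2 - α) * w x ^ 2 := by
  set f : (Fin N → ℝ) → ℝ := fun x => 1 * (γ - x n ^ (2 - α)) with hf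
  set g : (Fin N → ℝ) → ℝ := fun x => x n * w x ^ 2 with hg
  have hfC : ContDiff ℝ 1 f := contDiff_const.mul <| contDiff_const.sub <|
    (contDiff_apply ℝ ℝ n).rpow_const_of_le (m := 1) (by push_cast; linarith)
  have hgC : ContDiff ℝ 1 g := (contDiff_apply ℝ ℝ n).mul (hw.pow 2)
  have hgsub : tsupport g ⊆ tsupport w :=
    closure_mono fun x hx hwx => hx (by simp [hg, hwx])
  have hgc : HasCompactSupport g := hc.of_isClosed_subset (isClosed_tsupport g) hgsub
  have hf' : Continuous fun x => fderiv ℝ f x (Pi.single n 1) :=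
    (hfC.continuous_fderiv one_ne_zero).clm_apply continuous_const
  have hg' : Continuous fun x => fderiv ℝ g x (Pi.single n 1) :=
    (hgC.continuous_fderiv one_ne_zero).clm_apply continuous_const
  have key := integral_mul_fderiv_eq_neg_fderiv_mul_of_integrable
    (μ := (volume : Measure (Fin N → ℝ))) (f := f) (g := g) (v := Pi.single n 1)
    ((hf'.mul hgC.continuous).integrable_of_hasCompactSupport hgc.mul_left)
    ((hfC.continuous.mul hg').integrable_of_hasCompactSupport (hgc.fderiv_apply ℝ _).mul_left)
    ((hfC.continuous.mul hgC.continuous).integrable_of_hasCompactSupport hgc.mul_left)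
    (fun x _ => hfC.differentiable one_ne_zero x) (fun x _ => hgC.differentiable one_ne_zero x)
  have hg0 : ∀ x, x ∉ Ω → x ∉ tsupport g := fun x hx h => hx (hsupp (hgsub h))
  have hleft : ∫ x in Ω, f x * fderiv ℝ g x (Pi.single n 1) =
      ∫ x, f x * fderiv ℝ g x (Pi.single n 1) :=
    setIntegral_eq_integral_of_forall_compl_eq_zero fun x hx => by
      simp [fderiv_of_notMem_tsupport ℝ (hg0 x hx)]
  have hright : ∫ x in Ω, fderiv ℝ f x (Pi.single n 1) * g x =
      ∫ x, fderiv ℝ f x (Pi.single n 1) * g x :=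
    setIntegral_eq_integral_of_forall_compl_eq_zero fun x hx => by
      simp [image_eq_zero_of_notMem_tsupport (hg0 x hx)]
  rw [← hleft, ← hright, ← integral_neg] at key
  rw [← integral_const_mul]
  convert key using 1
  · refine setIntegral_congr_fun hΩ fun x _ => ?_
    simp only [hf, one_mul]
    rw [← pd_coord_mul_sq (hw.differentiable one_ne_zero x)]
    rfl
  · refine setIntegral_congr_fun hΩ fun x hx => ?_
    have hr : x n ^ (2 - α) = x n ^ (1 - α) * x n := by
      rw [← Real.rpow_add_one (ne_of_gt (hpos hx))]
      ring_nf
    have hfx : fderiv ℝ f x (Pi.single n 1) = -(2 - α) * 1 * x n ^ (1 - α) :=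
      pd_comp_coord_self (hasDerivAt_weight hα 1 γ (x n))
    simp only [hfx, hg, hr]
    ring

/-- Time slices of a compactly supported function are compactly supported. -/
theorem slice_hasCompactSupport {X Y : Type*} [TopologicalSpace X] [T2Space X]
    [TopologicalSpace Y] {z : X → Y → ℝ} {Ω : Set X} {I : Set Y}
    (hcs : HasCompactSupport fun p : X × Y => z p.1 p.2)
    (hsupp : tsupport (fun p : X × Y => z p.1 p.2) ⊆ Ω ×ˢ I) (t : Y) :
    HasCompactSupport (fun x => z x t) ∧ tsupport (fun x => z x t) ⊆ Ω := by
  set K : Set X := Prod.fst '' tsupport fun p : X × Y => z p.1 p.2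
  have hK : IsCompact K := hcs.isCompact.image continuous_fst
  have hsub : tsupport (fun x => z x t) ⊆ K := closure_minimal
    (fun x hx => ⟨(x, t), subset_tsupport (fun p : X × Y => z p.1 p.2) hx, rfl⟩) hK.isClosed
  refine ⟨hK.of_isClosed_subset (isClosed_tsupport _) hsub, hsub.trans ?_⟩
  rintro _ ⟨p, hp, rfl⟩
  exact (hsupp hp).1

/-- Step c) of the Carleman computation: the pairing `(P₁₂z + P₁₃z, P₂₂z)`
(compact-support case). -/
theorem carleman_step_c
    (N : ℕ) (hN : 2 ≤ N) (n : Fin N) (hn : (n : ℕ) = N - 1)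
    (α T γ s : ℝ) (hα : α ∈ Ioo (0 : ℝ) 1) (hT : 0 < T) (hs : 0 < s)
    (Ω : Set (Fin N → ℝ)) (hΩo : IsOpen Ω) (hΩb : Bornology.IsBounded Ω)
    (hΩs : Ω ⊆ {x | 0 < x n})
    (z : (Fin N → ℝ) → ℝ → ℝ)
    (hz : ContDiff ℝ (⊤ : ℕ∞) (fun p : (Fin N → ℝ) × ℝ => z p.1 p.2))
    (hcs : HasCompactSupport (fun p : (Fin N → ℝ) × ℝ => z p.1 p.2))
    (hsupp : tsupport (fun p : (Fin N → ℝ) × ℝ => z p.1 p.2) ⊆ Ω ×ˢ Ioo (0 : ℝ) T) :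
    ∫ t in Ioo (0 : ℝ) T, ∫ x in Ω,
        (2 * s * agrad α n (fun x' => z x' t) (fun x' => xi n α T γ x' t) x
            + s * z x t * divA α n (fun x' => xi n α T γ x' t) x)
          * (s * z x t * deriv (fun τ => xi n α T γ x τ) t)
      = -(2 - α) ^ 2 * s ^ 2 * (∫ t in Ioo (0 : ℝ) T, ∫ x in Ω,
          Theta T t * deriv (Theta T) t * x n ^ (2 - α) * (z x t) ^ 2) := by
  rw [← integral_const_mul]
  refine setIntegral_congr_fun measurableSet_Ioo fun t _ => ?_
  obtain ⟨hc, hsub⟩ := slice_hasCompactSupport hcs hsupp t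
  have hw : ContDiff ℝ 1 fun x => z x t :=
    (hz.of_le (mod_cast le_top)).comp (contDiff_id.prodMk contDiff_const)
  have key := setIntegral_weight_mul_pd n hα.2 γ hΩo.measurableSet hΩs hw hc hsub
  have hL : ∀ x ∈ Ω, (2 * s * agrad α n (fun x' => z x' t) (fun x' => xi n α T γ x' t) x
        + s * z x t * divA α n (fun x' => xi n α T γ x' t) x)
          * (s * z x t * deriv (fun τ => xi n α T γ x τ) t) =
      -(2 - α) * s ^ 2 * (Theta T t * deriv (Theta T) t) * ((γ - x n ^ (2 - α)) *
        (2 * x n * z x t * pd n (fun x' => z x' t) x + z x t ^ 2)) := fun x hx => by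
    rw [agrad_xi hα.2 (hΩs hx), divA_xi hα.2 (hΩs hx), deriv_xi]
    ring
  simp only [mul_assoc (Theta T t * deriv (Theta T) t)]
  rw [setIntegral_congr_fun hΩo.measurableSet hL, integral_const_mul, integral_const_mul, key]
  ring
end
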